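/- Suppose the sign of the edge {u,v} is flipped from + to −. Let Threshold = |N_{G⁺}(u) Δ N_{G⁺}(w)|, and suppose w ∈ N_{G⁺}(u) \ N_{G⁺}(v), |N_{G⁺}(u)| > |N_{G⁺}(w)|, and w ≠ v. Then: (a) Threshold < |N_{G⁺}(u)| implies NonAgreement_{G⁺}(u,w) > NonAgreement_{H⁺}(u,w); (b) Threshold = |N_{G⁺}(u)| implies NonAgreement_{G⁺}(u,w) = NonAgreement_{H⁺}(u,w); (c) Threshold > |N_{G⁺}(u)| implies NonAgreement_{G⁺}(u,w) < NonAgreement_{H⁺}(u,w). -/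

import Mathlib

open SimpleGraph

/-- `NonAgreement G x y = |N_G(x) Δ N_G(y)| / max(|N_G(x)|, |N_G(y)|)` as a rational number. -/
noncomputable def NonAgreement {V : Type*} [Fintype V] (G : SimpleGraph V) (x y : V) : ℚ :=
  ((symmDiff (G.neighborSet x) (G.neighborSet y)).ncard : ℚ) /
    ((max (G.neighborSet x).ncard (G.neighborSet y).ncard : ℕ) : ℚ)

/-- Deleting the edge `{u, v}` removes exactly `v` from the neighborhood of `u`. -/
theorem neighborSet_deleteEdges_pair_left {V : Type*} (G : SimpleGraph V) (u v : V) :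
    (G.deleteEdges {s(u, v)}).neighborSet u = G.neighborSet u \ {v} := by
  ext x
  simp only [mem_neighborSet, deleteEdges_adj, Set.mem_singleton_iff, Set.mem_sdiff, Sym2.eq_iff]
  grind

/-- Deleting the edge `{u, v}` does not affect the neighborhoods of other vertices. -/
theorem neighborSet_deleteEdges_pair_of_ne {V : Type*} (G : SimpleGraph V) {u v w : V}
    (hu : w ≠ u) (hv : w ≠ v) :
    (G.deleteEdges {s(u, v)}).neighborSet w = G.neighborSet w := by
  ext x
  simp only [mem_neighborSet, deleteEdges_adj, Set.mem_singleton_iff, Sym2.eq_iff]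
  grind

theorem stmt15 {V : Type*} [Fintype V] (G H : SimpleGraph V) (u v w : V)
    (huv : u ≠ v) (hadj : G.Adj u v)
    (hH : H = G.deleteEdges {s(u, v)})
    (hwu : w ∈ G.neighborSet u) (hwv : w ∉ G.neighborSet v)
    (hdeg : (G.neighborSet u).ncard > (G.neighborSet w).ncard) (hwne : w ≠ v) :
    ((symmDiff (G.neighborSet u) (G.neighborSet w)).ncard < (G.neighborSet u).ncard →
        NonAgreement G u w > NonAgreement H u w) ∧
      ((symmDiff (G.neighborSet u) (G.neighborSet w)).ncard = (G.neighborSet u).ncard →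
        NonAgreement G u w = NonAgreement H u w) ∧
      ((symmDiff (G.neighborSet u) (G.neighborSet w)).ncard > (G.neighborSet u).ncard →
        NonAgreement G u w < NonAgreement H u w) := by
  subst hH
  rw [mem_neighborSet] at hwu hwv
  have hvw : v ∉ G.neighborSet w := fun h ↦ hwv h.symm
  have hvD : v ∈ symmDiff (G.neighborSet u) (G.neighborSet w) := Or.inl ⟨hadj, hvw⟩
  have hD : symmDiff (G.neighborSet u \ {v}) (G.neighborSet w) =
      symmDiff (G.neighborSet u) (G.neighborSet w) \ {v} := by
    ext x
    simp only [Set.mem_symmDiff, Set.mem_sdiff, Set.mem_singleton_iff]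
    grind
  have hcardD := Set.ncard_sdiff_singleton_add_one hvD (Set.toFinite _)
  have hcardN := Set.ncard_sdiff_singleton_add_one (s := G.neighborSet u) hadj (Set.toFinite _)
  have hpos : 0 < (G.neighborSet w).ncard :=
    (Set.ncard_pos (Set.toFinite _)).2 ⟨u, hwu.symm⟩
  unfold NonAgreement
  rw [neighborSet_deleteEdges_pair_left, neighborSet_deleteEdges_pair_of_ne G hwu.ne' hwne, hD,
    max_eq_left hdeg.le, max_eq_left (by omega : _ ≤ (G.neighborSet u \ {v}).ncard),
    ← hcardD, ← hcardN]
  have hd : (0 : ℚ) < (G.neighborSet u \ {v}).ncard := by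
    exact_mod_cast (by omega : 0 < (G.neighborSet u \ {v}).ncard)
  generalize (G.neighborSet u \ {v}).ncard = d at hd ⊢
  generalize (symmDiff (G.neighborSet u) (G.neighborSet w) \ {v}).ncard = t
  push_cast
  refine ⟨fun h ↦ ?_, fun h ↦ ?_, fun h ↦ ?_⟩
  · have h' : (t : ℚ) + 1 < d + 1 := by exact_mod_cast h
    rw [gt_iff_lt, div_lt_div_iff₀ hd (by positivity)]
    linarith
  · obtain rfl : t = d := by omega
    rw [div_self hd.ne', div_self (by positivity)]
  · have h' : (d : ℚ) + 1 < t + 1 := by exact_mod_cast h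
    rw [div_lt_div_iff₀ (by positivity) hd]
    linarith
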